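/- arXiv:1409.7852 — 3 statements merged into one kernel-verified Lean document; each statement's English description precedes it below -/
import Mathlib

section
/- The determinant of the extended matrix A_ex equals the determinant of A up to sign: |det A_ex| = |det A|. Here A_ex is the ((2p+1)N − 2p)×((2p+1)N − 2p) real matrix acting on the concatenated variable vector (x_1,…,x_N, l_1,…,l_{N−1}, r_2,…,r_N) with x_i ∈ ℝ and l_k, r_k ∈ ℝ^p, whose rows, in order, are the scalar linear forms E_1,…,E_N followed by the ℝ^p-valued linear forms L_1,…,L_{N−1}, R_2,…,R_N (each contributing p scalar rows), given by E_i = ⟨v(i), l_{i−1}⟩ + a(i)·x_i + ⟨u(i), r_{i+1}⟩ (with l_0 and r_{N+1} read as 0 ∈ ℝ^p), L_1 = l_1 − x_1·u(1), L_k = l_k − x_k·u(k) − l_{k−1} for 2 ≤ k ≤ N−1, R_N = r_N − x_N·v(N), and R_k = r_k − x_k·v(k) − r_{k+1} for 2 ≤ k ≤ N−1. -/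
/-- The transfer matrix expressing `l_k = ∑_{j ≤ k} x_j u(j)` and `r_k = ∑_{j ≥ k} x_j v(j)`
in terms of `x`. -/
def semiseparableTransfer (N p : ℕ) (u v : ℕ → Fin p → ℝ) :
    Matrix (Fin (N - 1) × Fin p ⊕ Fin (N - 1) × Fin p) (Fin N) ℝ :=
  Matrix.of fun s j => match s with
    | Sum.inl (k, c) => if j.val ≤ k.val then u j.val c else 0
    | Sum.inr (k, c) => if k.val + 1 ≤ j.val then v j.val c else 0

/-- The lower bidiagonal matrix with `1` on the diagonal and `-1` below it. -/
def lowerDifference (n : ℕ) : Matrix (Fin n) (Fin n) ℝ :=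
  Matrix.of fun i j => if i = j then 1 else if j.val + 1 = i.val then -1 else 0

theorem det_lowerDifference (n : ℕ) : (lowerDifference n).det = 1 := by
  rw [Matrix.det_of_isLowerTriangular]
  · simp [lowerDifference]
  · intro i j hij
    have h : i.val < j.val := hij
    have h1 : i ≠ j := fun e => by simp [e] at h
    have h2 : ¬ j.val + 1 = i.val := by omega
    simp [lowerDifference, h1, h2]

/-- `|det A_ex| = |det A|` for the rank-`p` case. The extended matrix
`A_ex` acts on the concatenated variable vector
`(x_1,…,x_N, l_1,…,l_{N-1}, r_2,…,r_N)` with `x_i ∈ ℝ` and `l_k, r_k ∈ ℝ^p`, encoded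
by the index type `Fin N ⊕ (Fin (N-1) × Fin p ⊕ Fin (N-1) × Fin p)`: `Sum.inl i`
holds `x_{i+1}`, `Sum.inr (Sum.inl (k, c))` holds component `c` of `l_{k+1}`, and
`Sum.inr (Sum.inr (k, c))` holds component `c` of `r_{k+2}` (1-based names). Its rows
are the scalar forms `E_1,…,E_N` followed by the `p` scalar rows of each of
`L_1,…,L_{N-1}, R_2,…,R_N`, specified through the action of `A_ex` on every vector. -/
theorem stmt_5 (N p : ℕ) (hN : 2 ≤ N) (hp : 1 ≤ p) (a : ℕ → ℝ)
    (u v : ℕ → Fin p → ℝ)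
    (A : Matrix (Fin N) (Fin N) ℝ)
    (hA : ∀ i j : Fin N, A i j = if i = j then a i.val
      else ∑ c : Fin p, u (min i.val j.val) c * v (max i.val j.val) c)
    (Aex : Matrix (Fin N ⊕ (Fin (N - 1) × Fin p ⊕ Fin (N - 1) × Fin p))
                  (Fin N ⊕ (Fin (N - 1) × Fin p ⊕ Fin (N - 1) × Fin p)) ℝ)
    (hEx : ∀ y : (Fin N ⊕ (Fin (N - 1) × Fin p ⊕ Fin (N - 1) × Fin p)) → ℝ,
      -- rows E_i :  ⟨v(i), l_{i-1}⟩ + a(i)·x_i + ⟨u(i), r_{i+1}⟩  (l_0, r_{N+1} read as 0)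
      (∀ i : Fin N, Aex.mulVec y (Sum.inl i) =
        (if h : 1 ≤ i.val then ∑ c : Fin p, v i.val c *
            y (Sum.inr (Sum.inl (⟨i.val - 1, by have := i.isLt; omega⟩, c))) else 0)
        + a i.val * y (Sum.inl i)
        + (if h : i.val + 2 ≤ N then ∑ c : Fin p, u i.val c *
            y (Sum.inr (Sum.inr (⟨i.val, by omega⟩, c))) else 0))
      ∧
      -- rows L_k :  l_k - x_k·u(k) - l_{k-1}  (componentwise, l_0 read as 0)
      (∀ (k : Fin (N - 1)) (c : Fin p), Aex.mulVec y (Sum.inr (Sum.inl (k, c))) =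
        y (Sum.inr (Sum.inl (k, c)))
        - y (Sum.inl ⟨k.val, by have := k.isLt; omega⟩) * u k.val c
        - (if h : 1 ≤ k.val then
            y (Sum.inr (Sum.inl (⟨k.val - 1, by have := k.isLt; omega⟩, c))) else 0))
      ∧
      -- rows R_{k+2} :  r_{k+2} - x_{k+2}·v(k+2) - r_{k+3}  (componentwise, r_{N+1} read as 0)
      (∀ (k : Fin (N - 1)) (c : Fin p), Aex.mulVec y (Sum.inr (Sum.inr (k, c))) =
        y (Sum.inr (Sum.inr (k, c)))
        - y (Sum.inl ⟨k.val + 1, by have := k.isLt; omega⟩) * v (k.val + 1) c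
        - (if h : k.val + 1 < N - 1 then
            y (Sum.inr (Sum.inr (⟨k.val + 1, h⟩, c))) else 0))) :
    |Aex.det| = |A.det| := by
  have hS : Aex * Matrix.fromBlocks 1 0 (semiseparableTransfer N p u v) 1 =
      Matrix.fromBlocks A Aex.toBlocks₁₂ 0
        (Matrix.fromBlocks
          (Matrix.kroneckerMap (· * ·) (lowerDifference (N - 1)) (1 : Matrix (Fin p) (Fin p) ℝ)) 0 0
          (Matrix.kroneckerMap (· * ·) (lowerDifference (N - 1)).transpose
            (1 : Matrix (Fin p) (Fin p) ℝ))) := by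
    ext s t
    change Aex.mulVec (fun w => Matrix.fromBlocks 1 0 (semiseparableTransfer N p u v) 1 w t) s = _
    obtain ⟨hE, hL, hR⟩ :=
      hEx fun w => Matrix.fromBlocks 1 0 (semiseparableTransfer N p u v) 1 w t
    rcases s with i | ⟨k, c⟩ | ⟨k, c⟩
    · rcases t with j | t
      · rw [hE]
        simp only [Matrix.fromBlocks_apply₁₁, Matrix.fromBlocks_apply₂₁, semiseparableTransfer,
          Matrix.of_apply, Matrix.one_apply, hA]
        rcases lt_trichotomy i.val j.val with h | h | h
        · have h1 : i ≠ j := fun e => by simp [e] at h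
          have h2 : ¬ j.val ≤ i.val - 1 := by omega
          have h3 : i.val + 2 ≤ N := by omega
          have h4 : i.val + 1 ≤ j.val := h
          simp [h1, h2, h3, h4, min_eq_left h.le, max_eq_right h.le]
        · obtain rfl : i = j := Fin.ext h
          have h2 : 1 ≤ i.val → ¬ i.val ≤ i.val - 1 := by omega
          simp +contextual [h2]
        · have h1 : i ≠ j := fun e => by simp [e] at h
          have h2 : j.val ≤ i.val - 1 := by omega
          have h3 : 1 ≤ i.val := by omega
          have h4 : ¬ i.val + 1 ≤ j.val := by omega
          simp [h1, h2, h3, h4, min_eq_right h.le, max_eq_left h.le, mul_comm]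
      · rw [Matrix.mulVec, dotProduct, Fintype.sum_sum_type]
        simp [Matrix.one_apply, Matrix.toBlocks₁₂, -Fintype.sum_sum_type]
    · rw [hL]
      rcases t with j | ⟨k', c'⟩ | ⟨k', c'⟩
      · simp [semiseparableTransfer, Matrix.one_apply, Fin.ext_iff]
        grind
      · simp [Matrix.one_apply, lowerDifference, Fin.ext_iff]
        grind
      · simp
    · rw [hR]
      rcases t with j | ⟨k', c'⟩ | ⟨k', c'⟩
      · simp [semiseparableTransfer, Matrix.one_apply, Fin.ext_iff]
        grind
      · simp
      · simp [Matrix.one_apply, lowerDifference, Fin.ext_iff]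
        grind
  have hdet := congrArg Matrix.det hS
  rw [Matrix.det_mul, Matrix.det_fromBlocks_zero₁₂, Matrix.det_fromBlocks_zero₂₁,
    Matrix.det_fromBlocks_zero₂₁, Matrix.det_kronecker, Matrix.det_kronecker,
    Matrix.det_transpose, det_lowerDifference] at hdet
  simp only [Matrix.det_one, one_pow, mul_one] at hdet
  rw [hdet]
end

section
/- The rank-p semi-separable matrix A is invertible if and only if the extended matrix A_ex is invertible, where A_ex is the ((2p+1)N − 2p)×((2p+1)N − 2p) real matrix acting on the concatenated variable vector (x_1,…,x_N, l_1,…,l_{N−1}, r_2,…,r_N) with x_i ∈ ℝ and l_k, r_k ∈ ℝ^p, whose rows, in order, are the scalar linear forms E_1,…,E_N followed by the ℝ^p-valued linear forms L_1,…,L_{N−1}, R_2,…,R_N, given by E_i = ⟨v(i), l_{i−1}⟩ + a(i)·x_i + ⟨u(i), r_{i+1}⟩ (with l_0 and r_{N+1} read as 0 ∈ ℝ^p), L_1 = l_1 − x_1·u(1), L_k = l_k − x_k·u(k) − l_{k−1} for 2 ≤ k ≤ N−1, R_N = r_N − x_N·v(N), and R_k = r_k − x_k·v(k) − r_{k+1}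 for 2 ≤ k ≤ N−1. -/
open Finset in
/-- The product of a semi-separable matrix with a vector, split into the contributions below, on,
and above the diagonal. -/
theorem semiseparable_mulVec_apply {N p : ℕ} (a : ℕ → ℝ) (u v : ℕ → Fin p → ℝ)
    (A : Matrix (Fin N) (Fin N) ℝ)
    (hA : ∀ i j : Fin N, A i j = if i = j then a i.val
      else ∑ c : Fin p, u (min i.val j.val) c * v (max i.val j.val) c)
    (x : ℕ → ℝ) (i : Fin N) :
    A.mulVec (fun j => x j.val) i =
      ∑ c, v i.val c * ∑ j ∈ range i.val, x j * u j c + a i.val * x i.val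
        + ∑ c, u i.val c * ∑ j ∈ Ico (i.val + 1) N, x j * v j c := by
  let g : ℕ → ℝ := fun j => (if i.val = j then a i.val
      else ∑ c : Fin p, u (min i.val j) c * v (max i.val j) c) * x j
  have hg : A.mulVec (fun j => x j.val) i = ∑ j ∈ range N, g j := by
    rw [← Fin.sum_univ_eq_sum_range]
    simp only [Matrix.mulVec, dotProduct, hA, g, Fin.ext_iff]
  have hlow : ∑ j ∈ range i.val, g j = ∑ c, v i.val c * ∑ j ∈ range i.val, x j * u j c := by
    simp_rw [mul_sum]
    rw [sum_comm]
    refine sum_congr rfl fun j hj => ?_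
    have hj := mem_range.mp hj
    simp only [g, if_neg hj.ne', min_eq_right hj.le, max_eq_left hj.le, sum_mul]
    exact sum_congr rfl fun c _ => by ring
  have hhigh : ∑ j ∈ Ico (i.val + 1) N, g j
      = ∑ c, u i.val c * ∑ j ∈ Ico (i.val + 1) N, x j * v j c := by
    simp_rw [mul_sum]
    rw [sum_comm]
    refine sum_congr rfl fun j hj => ?_
    have hj : i.val < j := (mem_Ico.mp hj).1
    simp only [g, if_neg hj.ne, min_eq_left hj.le, max_eq_right hj.le, sum_mul]
    exact sum_congr rfl fun c _ => by ring
  rw [hg, ← sum_range_add_sum_Ico g (Nat.succ_le_of_lt i.isLt), sum_range_succ, hlow, hhigh]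
  simp [g]

open Finset in
theorem forward_recurrence_iff_eq_sum_range {n : ℕ} (l : Fin n → ℝ) (f : ℕ → ℝ) :
    (∀ k : Fin n, l k - f k.val
      - (if h : 1 ≤ k.val then l ⟨k.val - 1, by have := k.isLt; omega⟩ else 0) = 0) ↔
    ∀ k : Fin n, l k = ∑ j ∈ range (k.val + 1), f j := by
  constructor
  · rintro H ⟨k, hk⟩
    induction k with
    | zero => simpa [sub_eq_zero] using H ⟨0, hk⟩
    | succ k ih =>
      have h := H ⟨k + 1, hk⟩
      have h' := ih (by omega)
      simp only [Nat.le_add_left, dite_true, Nat.add_sub_cancel] at h h' ⊢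
      rw [sum_range_succ]
      linarith
  · rintro H ⟨k, hk⟩
    cases k with
    | zero => simp [H]
    | succ k => simp [H, sum_range_succ _ (k + 1)]

open Finset in
theorem backward_recurrence_iff_eq_sum_Ico {N : ℕ} (r : Fin (N - 1) → ℝ) (f : ℕ → ℝ) :
    (∀ k : Fin (N - 1), r k - f (k.val + 1)
      - (if h : k.val + 1 < N - 1 then r ⟨k.val + 1, h⟩ else 0) = 0) ↔
    ∀ k : Fin (N - 1), r k = ∑ j ∈ Ico (k.val + 1) N, f j := by
  have hsplit (k : Fin (N - 1)) : ∑ j ∈ Ico (k.val + 1) N, f j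
      = f (k.val + 1) + ∑ j ∈ Ico (k.val + 1 + 1) N, f j :=
    sum_eq_sum_Ico_succ_bot (by have := k.isLt; omega) f
  constructor
  · rintro H ⟨k, hk⟩
    induction hm : N - 1 - k generalizing k with
    | zero => omega
    | succ m ih =>
      have h := H ⟨k, hk⟩
      have hs := hsplit ⟨k, hk⟩
      by_cases hk' : k + 1 < N - 1
      · have h' := ih (k + 1) hk' (by omega)
        simp only [hk', dite_true] at h h' hs ⊢
        linarith
      · simp only [hk', dite_false] at h hs ⊢
        rw [Ico_eq_empty_of_le (a := k + 1 + 1) (by omega), sum_empty] at hs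
        linarith
  · intro H k
    rw [H k, hsplit k]
    split_ifs with h
    · simp [H]
    · rw [Ico_eq_empty_of_le (a := k.val + 1 + 1) (by omega)]
      simp

theorem Matrix.isUnit_iff_forall_mulVec_eq_zero {n K : Type*} [Fintype n] [DecidableEq n] [Field K]
    (M : Matrix n n K) : IsUnit M ↔ ∀ x, M.mulVec x = 0 → x = 0 := by
  rw [← Matrix.mulVec_injective_iff_isUnit]
  exact injective_iff_map_eq_zero M.mulVecLin

/-- the rank-`p` semi-separable matrix `A` is invertible iff `A_ex` is. The extended matrix
`A_ex` acts on the concatenated variable vector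
`(x_1,…,x_N, l_1,…,l_{N-1}, r_2,…,r_N)` with `x_i ∈ ℝ` and `l_k, r_k ∈ ℝ^p`, encoded
by the index type `Fin N ⊕ (Fin (N-1) × Fin p ⊕ Fin (N-1) × Fin p)`: `Sum.inl i`
holds `x_{i+1}`, `Sum.inr (Sum.inl (k, c))` holds component `c` of `l_{k+1}`, and
`Sum.inr (Sum.inr (k, c))` holds component `c` of `r_{k+2}` (1-based names). Its rows
are the scalar forms `E_1,…,E_N` followed by the `p` scalar rows of each of
`L_1,…,L_{N-1}, R_2,…,R_N`, specified through the action of `A_ex` on every vector. -/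
theorem stmt_6 (N p : ℕ) (hN : 2 ≤ N) (hp : 1 ≤ p) (a : ℕ → ℝ)
    (u v : ℕ → Fin p → ℝ)
    (A : Matrix (Fin N) (Fin N) ℝ)
    (hA : ∀ i j : Fin N, A i j = if i = j then a i.val
      else ∑ c : Fin p, u (min i.val j.val) c * v (max i.val j.val) c)
    (Aex : Matrix (Fin N ⊕ (Fin (N - 1) × Fin p ⊕ Fin (N - 1) × Fin p))
                  (Fin N ⊕ (Fin (N - 1) × Fin p ⊕ Fin (N - 1) × Fin p)) ℝ)
    (hEx : ∀ y : (Fin N ⊕ (Fin (N - 1) × Fin p ⊕ Fin (N - 1) × Fin p)) → ℝ,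
      -- rows E_i :  ⟨v(i), l_{i-1}⟩ + a(i)·x_i + ⟨u(i), r_{i+1}⟩  (l_0, r_{N+1} read as 0)
      (∀ i : Fin N, Aex.mulVec y (Sum.inl i) =
        (if h : 1 ≤ i.val then ∑ c : Fin p, v i.val c *
            y (Sum.inr (Sum.inl (⟨i.val - 1, by have := i.isLt; omega⟩, c))) else 0)
        + a i.val * y (Sum.inl i)
        + (if h : i.val + 2 ≤ N then ∑ c : Fin p, u i.val c *
            y (Sum.inr (Sum.inr (⟨i.val, by omega⟩, c))) else 0))
      ∧
      -- rows L_k :  l_k - x_k·u(k) - l_{k-1}  (componentwise, l_0 read as 0)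
      (∀ (k : Fin (N - 1)) (c : Fin p), Aex.mulVec y (Sum.inr (Sum.inl (k, c))) =
        y (Sum.inr (Sum.inl (k, c)))
        - y (Sum.inl ⟨k.val, by have := k.isLt; omega⟩) * u k.val c
        - (if h : 1 ≤ k.val then
            y (Sum.inr (Sum.inl (⟨k.val - 1, by have := k.isLt; omega⟩, c))) else 0))
      ∧
      -- rows R_{k+2} :  r_{k+2} - x_{k+2}·v(k+2) - r_{k+3}  (componentwise, r_{N+1} read as 0)
      (∀ (k : Fin (N - 1)) (c : Fin p), Aex.mulVec y (Sum.inr (Sum.inr (k, c))) =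
        y (Sum.inr (Sum.inr (k, c)))
        - y (Sum.inl ⟨k.val + 1, by have := k.isLt; omega⟩) * v (k.val + 1) c
        - (if h : k.val + 1 < N - 1 then
            y (Sum.inr (Sum.inr (⟨k.val + 1, h⟩, c))) else 0))) :
    IsUnit A ↔ IsUnit Aex := by
  have key (x : ℕ → ℝ) (y : (Fin N ⊕ (Fin (N - 1) × Fin p ⊕ Fin (N - 1) × Fin p)) → ℝ)
      (hx : ∀ i : Fin N, y (Sum.inl i) = x i.val) : Aex.mulVec y = 0 ↔
      A.mulVec (fun j => x j.val) = 0 ∧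
      (∀ c k, y (Sum.inr (Sum.inl (k, c))) = ∑ j ∈ Finset.range (k.val + 1), x j * u j c) ∧
      (∀ c k, y (Sum.inr (Sum.inr (k, c))) = ∑ j ∈ Finset.Ico (k.val + 1) N, x j * v j c) := by
    obtain ⟨hE, hL, hR⟩ := hEx y
    have hl (c : Fin p) := forward_recurrence_iff_eq_sum_range
      (fun k => y (Sum.inr (Sum.inl (k, c)))) (fun j => x j * u j c)
    have hr (c : Fin p) := backward_recurrence_iff_eq_sum_Ico
      (fun k => y (Sum.inr (Sum.inr (k, c)))) (fun j => x j * v j c)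
    simp only [← hl, ← hr, funext_iff, Sum.forall, Prod.forall, hL, hR, hx, Pi.zero_apply]
    rw [forall_comm (α := Fin (N - 1)), forall_comm (α := Fin (N - 1))]
    refine and_congr_left fun ⟨Hl, Hr⟩ => forall_congr' fun i => ?_
    have Hl := fun c => (hl c).1 (Hl c)
    have Hr := fun c => (hr c).1 (Hr c)
    rw [semiseparable_mulVec_apply a u v A hA, hE]
    simp only [Hl, Hr, hx]
    have hi := i.isLt
    congr! 3
    · split_ifs with h
      · rw [Nat.sub_add_cancel h]
      · rw [show i.val = 0 by omega]
        simp
    · split_ifs with h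
      · rfl
      · rw [Finset.Ico_eq_empty_of_le (by omega)]
        simp
  rw [A.isUnit_iff_forall_mulVec_eq_zero, Aex.isUnit_iff_forall_mulVec_eq_zero]
  have hext (x : Fin N → ℝ) (i : Fin N) : Function.extend Fin.val x 0 i.val = x i :=
    Fin.val_injective.extend_apply x 0 i
  constructor
  · intro H y hy
    obtain ⟨h, hl, hr⟩ := (key _ y fun i => (hext (fun i => y (Sum.inl i)) i).symm).1 hy
    simp only [hext] at h
    have hzero : Function.extend (Fin.val : Fin N → ℕ) (fun i => y (Sum.inl i)) 0 = 0 := by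
      rw [H _ h]
      exact Function.extend_zero _
    rw [hzero] at hl hr
    ext (i | ⟨k, c⟩ | ⟨k, c⟩)
    · exact congrFun (H _ h) i
    · simp [hl]
    · simp [hr]
  · intro H x hx
    let z : ℕ → ℝ := Function.extend Fin.val x 0
    let y : (Fin N ⊕ (Fin (N - 1) × Fin p ⊕ Fin (N - 1) × Fin p)) → ℝ :=
      Sum.elim x (Sum.elim
        (fun q => ∑ j ∈ Finset.range (q.1.val + 1), z j * u j q.2)
        (fun q => ∑ j ∈ Finset.Ico (q.1.val + 1) N, z j * v j q.2))
    have hy : y = 0 := H y <| (key z y fun i => (hext x i).symm).2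
      ⟨by simpa only [z, hext] using hx, fun _ _ => rfl, fun _ _ => rfl⟩
    ext i
    exact congrFun hy (Sum.inl i)
end

section
/- The interleaved extended matrix A_ex′ is symmetric: A_ex′(i,j) = A_ex′(j,i) for all i, j. Here A_ex′ is the (3N−2)×(3N−2) real matrix acting on the unknowns ordered as (x_1, r_2, l_1, x_2, r_3, l_2, …, x_{N−1}, r_N, l_{N−1}, x_N), i.e., x_k in column position 3k−2 for 1 ≤ k ≤ N, r_{k+1} in position 3k−1 and l_k in position 3k for 1 ≤ k ≤ N−1, and whose rows are ordered as E_1, L_1, R_2, E_2, L_2, R_3, …, E_{N−1}, L_{N−1}, R_N, E_N (E_i in row position 3i−2, L_k in row position 3k−1, R_{k+1} in row position 3k), where E_i = v(i)·l_{i−1} + a(i)·x_i + u(i)·r_{i+1} (with l_0 and r_{N+1} read as 0), L_k = u(k)·x_k + l_{k−1} − l_k (with l_0 = 0), and R_k = v(k)·x_k + r_{k+1} − r_k (with r_{N+1} = 0). -/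
/-- the interleaved extended matrix `A_ex'` is symmetric.
Positions are 0-based: the unknown `x_k` (1-based `k`) sits in column `3(k-1)`, the
unknown `r_{k+1}` (for `1 ≤ k ≤ N-1`) in column `3k-2`, and `l_k` in column `3k-1`;
row `3(i-1)` is `E_i`, row `3k-2` is `L_k`, and row `3k-1` is `R_{k+1}` — exactly
the 1-based positions `3k-2, 3k-1, 3k` of the statement shifted by one.  The rows are
`E_i = v(i)·l_{i-1} + a(i)·x_i + u(i)·r_{i+1}` (`l_0 = r_{N+1} = 0`),
`L_k = u(k)·x_k + l_{k-1} - l_k` and `R_{k+1} = v(k+1)·x_{k+1} + r_{k+2} - r_{k+1}`,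
specified through the action of `A_ex'` on every vector `y`;
`a m, u m, v m` denote the 1-based `a(m+1), u(m+1), v(m+1)`. -/
theorem stmt_13 (N : ℕ) (hN : 2 ≤ N) (a u v : ℕ → ℝ)
    (Aex : Matrix (Fin (3 * N - 2)) (Fin (3 * N - 2)) ℝ)
    (hEx : ∀ y : Fin (3 * N - 2) → ℝ,
      -- rows E_{m+1}
      (∀ m, ∀ hm : m < N, Aex.mulVec y ⟨3 * m, by omega⟩ =
        v m * (if h : 1 ≤ m then y ⟨3 * m - 1, by omega⟩ else 0)
        + a m * y ⟨3 * m, by omega⟩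
        + u m * (if h : m + 2 ≤ N then y ⟨3 * m + 1, by omega⟩ else 0))
      ∧
      -- rows L_k, 1 ≤ k ≤ N-1
      (∀ k, ∀ hk1 : 1 ≤ k, ∀ hk2 : k < N, Aex.mulVec y ⟨3 * k - 2, by omega⟩ =
        u (k - 1) * y ⟨3 * (k - 1), by omega⟩
        + (if h : 2 ≤ k then y ⟨3 * k - 4, by omega⟩ else 0)
        - y ⟨3 * k - 1, by omega⟩)
      ∧
      -- rows R_{k+1}, 1 ≤ k ≤ N-1
      (∀ k, ∀ hk1 : 1 ≤ k, ∀ hk2 : k < N, Aex.mulVec y ⟨3 * k - 1, by omega⟩ =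
        v k * y ⟨3 * k, by omega⟩
        + (if h : k + 2 ≤ N then y ⟨3 * k + 1, by omega⟩ else 0)
        - y ⟨3 * k - 2, by omega⟩)) :
    ∀ i j : Fin (3 * N - 2), Aex i j = Aex j i := by
  have entry (i j) : Aex i j = Aex.mulVec (Pi.single j 1) i := by simp
  have rowE (m : ℕ) (hm : m < N) (j : Fin (3 * N - 2)) : Aex ⟨3 * m, by omega⟩ j =
      if j.val + 1 = 3 * m then v m else if j.val = 3 * m then a m
      else if j.val = 3 * m + 1 then u m else 0 := by
    rw [entry, (hEx _).1 m hm]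
    simp only [Pi.single_apply, Fin.ext_iff]
    grind
  have rowL (k : ℕ) (hk1 : 1 ≤ k) (hk2 : k < N) (j : Fin (3 * N - 2)) :
      Aex ⟨3 * k - 2, by omega⟩ j =
      if j.val + 3 = 3 * k then u (k - 1) else if j.val + 4 = 3 * k then 1
      else if j.val + 1 = 3 * k then -1 else 0 := by
    rw [entry, (hEx _).2.1 k hk1 hk2]
    simp only [Pi.single_apply, Fin.ext_iff]
    grind
  have rowR (k : ℕ) (hk1 : 1 ≤ k) (hk2 : k < N) (j : Fin (3 * N - 2)) :
      Aex ⟨3 * k - 1, by omega⟩ j =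
      if j.val = 3 * k then v k else if j.val = 3 * k + 1 then 1
      else if j.val + 2 = 3 * k then -1 else 0 := by
    rw [entry, (hEx _).2.2 k hk1 hk2]
    simp only [Pi.single_apply, Fin.ext_iff]
    grind
  have position (i : ℕ) (hi : i < 3 * N - 2) : (∃ m < N, i = 3 * m) ∨
      (∃ k, 1 ≤ k ∧ k < N ∧ i = 3 * k - 2) ∨ ∃ k, 1 ≤ k ∧ k < N ∧ i = 3 * k - 1 := by
    obtain ⟨k, hk | hk | hk⟩ : ∃ k, i = 3 * k ∨ i = 3 * k + 1 ∨ i = 3 * k + 2 :=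
      ⟨i / 3, by omega⟩
    · exact .inl ⟨k, by omega, hk⟩
    · exact .inr (.inl ⟨k + 1, by omega, by omega, by omega⟩)
    · exact .inr (.inr ⟨k + 1, by omega, by omega, by omega⟩)
  clear hEx entry
  rintro ⟨i, hi⟩ ⟨j, hj⟩
  rcases position i hi with ⟨m, hm, rfl⟩ | ⟨m, hm1, hm, rfl⟩ | ⟨m, hm1, hm, rfl⟩ <;>
  rcases position j hj with ⟨k, hk, rfl⟩ | ⟨k, hk1, hk, rfl⟩ | ⟨k, hk1, hk, rfl⟩ <;>
  clear position <;>
  simp only [*] <;>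
  clear rowE rowL rowR <;>
  grind
end
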